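/- Let P : g → g be ad-equivariant and let h, e ∈ g satisfy [h, e] = 2e. Then for every integer k ≥ 0: [e, dᵏP(h).e⁽ᵏ⁾] = −2·d^{k+1}P(h).e^{(k+1)}. -/

import Mathlib

/-- Along the line `t ↦ x + t • v`, the `k`-th derivative of `f` in direction `v` has derivative
the `(k + 1)`-st derivative of `f` in direction `v`. -/
theorem ContDiff.hasDerivAt_iteratedFDeriv_line {𝕜 E F : Type*} [NontriviallyNormedField 𝕜]
    [NormedAddCommGroup E] [NormedSpace 𝕜 E] [NormedAddCommGroup F] [NormedSpace 𝕜 F]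
    {f : E → F} {k : ℕ} (hf : ContDiff 𝕜 (k + 1 : ℕ) f) (x v : E) (t : 𝕜) :
    HasDerivAt (fun s : 𝕜 => iteratedFDeriv 𝕜 k f (x + s • v) (fun _ => v))
      (iteratedFDeriv 𝕜 (k + 1) f (x + t • v) (fun _ => v)) t := by
  have hline : HasDerivAt (fun s : 𝕜 => x + s • v) v t := by
    simpa using ((hasDerivAt_id t).smul_const v).const_add x
  have hdiff : DifferentiableAt 𝕜 (iteratedFDeriv 𝕜 k f) (x + t • v) :=
    (hf.differentiable_iteratedFDeriv (by exact_mod_cast k.lt_succ_self)) _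
  have hcomp := hdiff.hasFDerivAt.comp_hasDerivAt t hline
  exact (ContinuousMultilinearMap.apply 𝕜 (fun _ : Fin k => E) F
    (fun _ => v)).hasFDerivAt.comp_hasDerivAt t hcomp

theorem stmt {g : Type*} [NormedAddCommGroup g] [NormedSpace ℂ g] [FiniteDimensional ℂ g]
    -- `lie` is the Lie bracket of the finite-dimensional complex Lie algebra `g`,
    -- given as bilinear data so that it is compatible with the normed space structure.
    (lie : g →ₗ[ℂ] g →ₗ[ℂ] g)
    (lie_self : ∀ x : g, lie x x = 0)
    (lie_jacobi : ∀ x y z : g, lie x (lie y z) = lie (lie x y) z + lie y (lie x z))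
    (P : g → g) (hP : ContDiff ℂ ⊤ P)
    (hPeq : ∀ x y : g, fderiv ℂ P x (lie y x) = lie y (P x))
    (h e : g) (hhe : lie h e = (2 : ℂ) • e)
    (k : ℕ) :
    lie e (iteratedFDeriv ℂ k P h (fun _ => e))
      = (-2 : ℂ) • iteratedFDeriv ℂ (k + 1) P h (fun _ => e) := by
  have lie_e_h : lie e h = (-2 : ℂ) • e := by
    have hadd := lie_self (h + e)
    simp only [map_add, LinearMap.add_apply, lie_self, hhe, zero_add, add_zero] at hadd
    rw [neg_smul]
    exact eq_neg_of_add_eq_zero_left hadd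
  have hderiv (k : ℕ) (t : ℂ) :=
    (hP.of_le le_top : ContDiff ℂ (k + 1 : ℕ) P).hasDerivAt_iteratedFDeriv_line h e t
  have along_line (t : ℂ) : lie e (iteratedFDeriv ℂ k P (h + t • e) (fun _ => e))
      = (-2 : ℂ) • iteratedFDeriv ℂ (k + 1) P (h + t • e) (fun _ => e) := by
    induction k generalizing t with
    | zero =>
      have heq := hPeq (h + t • e) e
      rw [map_add, map_smul, lie_self, smul_zero, add_zero, lie_e_h, map_smul] at heq
      simpa [iteratedFDeriv_one_apply] using heq.symm
    | succ k ih =>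
      have hleft := (LinearMap.toContinuousLinearMap (lie e)).hasFDerivAt.comp_hasDerivAt t
        (hderiv k t)
      have hright := (hderiv (k + 1) t).const_smul (-2 : ℂ)
      exact hleft.unique (hright.congr_of_eventuallyEq (.of_forall ih))
  simpa using along_line 0
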